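/- Let η ∈ C_0^∞(ℝ) with supp η ⊂ [-1,1] and η ≡ 1 on [-1/2,1/2], and let b, b' satisfy -1/2 < b' ≤ 0 ≤ b ≤ b' + 1. Then there exists C > 0 (depending only on b, b', η) such that for every T ∈ (0,1] and every Schwartz function f : ℝ → ℂ, the function (Lf)(t) := η(t/T) ∫_0^t f(t') dt' satisfies (∫_ℝ ⟨τ⟩^{2b} |(Lf)^∧(τ)|² dτ)^{1/2} ≤ C T^{1-b+b'} (∫_ℝ ⟨τ⟩^{2b'} |f̂(τ)|² dτ)^{1/2}. -/

import Mathlib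

open MeasureTheory
open scoped Real

/-- Fourier transform on ℝ: `f̂(τ) = (2π)^{-1/2} ∫ e^{-iτt} f(t) dt`. -/
noncomputable def FT1 (f : ℝ → ℂ) (τ : ℝ) : ℂ :=
  (Real.sqrt (2 * π) : ℂ)⁻¹ * ∫ t : ℝ, Complex.exp (-Complex.I * τ * t) * f t

/-- The `H^r(ℝ)` norm: `(∫ ⟨τ⟩^{2r} |f̂(τ)|² dτ)^{1/2}`. -/
noncomputable def Hnorm (r : ℝ) (f : ℝ → ℂ) : ℝ :=
  Real.sqrt (∫ τ : ℝ, (1 + |τ|) ^ (2 * r) * ‖FT1 f τ‖ ^ 2)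


open scoped ENNReal FourierTransform

/-- The weight adapted to Mathlib's normalisation of the Fourier transform. -/
noncomputable def wt (w : ℝ) : ℝ := 1 + 2 * π * |w|

lemma wt_one_le (w : ℝ) : 1 ≤ wt w := by
  unfold wt; have := Real.pi_pos; have : 0 ≤ 2 * π * |w| := by positivity
  linarith

lemma wt_pos (w : ℝ) : 0 < wt w := lt_of_lt_of_le one_pos (wt_one_le w)

lemma wt_continuous : Continuous wt := by unfold wt; fun_prop

lemma wt_mul_le (x y : ℝ) : wt x ≤ wt y * wt (x - y) := by
  unfold wt
  have h : |x| ≤ |y| + |x - y| := by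
    have := abs_add_le y (x - y); simpa using this
  have hp := Real.pi_pos
  have h1 : 2 * π * |x| ≤ 2 * π * (|y| + |x - y|) := by gcongr
  have h2 : 0 ≤ (2 * π * |y|) * (2 * π * |x - y|) := by positivity
  nlinarith

lemma wt_rpow_continuous (r : ℝ) : Continuous (fun w => wt w ^ r) :=
  wt_continuous.rpow_const (fun w => Or.inl (wt_pos w).ne')

lemma integrable_wt {r : ℝ} (hr : 1 < r) : Integrable (fun w => wt w ^ (-r)) := by
  have h := integrable_one_add_norm (E := ℝ) (μ := volume) (r := r) (by simpa using hr)
  refine h.mono' (wt_rpow_continuous _).aestronglyMeasurable (ae_of_all _ fun w => ?_)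
  rw [Real.norm_of_nonneg (Real.rpow_nonneg (wt_pos w).le _)]
  refine Real.rpow_le_rpow_of_nonpos (by positivity) ?_ (by linarith)
  unfold wt
  have := Real.pi_gt_three
  have : 0 ≤ |w| := abs_nonneg w
  rw [Real.norm_eq_abs]; nlinarith

lemma schwartz_decay (Φ : SchwartzMap ℝ ℂ) :
    ∃ C > 0, ∀ x, ‖Φ x‖ ≤ C * wt x ^ (-3 : ℝ) := by
  obtain ⟨A, hA, hA'⟩ := Φ.decay 0 0
  obtain ⟨B, hB, hB'⟩ := Φ.decay 3 0
  refine ⟨8 * (A + (2 * π) ^ 3 * B), by positivity, fun x => ?_⟩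
  have h1 := hA' x
  have h2 := hB' x
  simp only [norm_iteratedFDeriv_zero, pow_zero, one_mul, Real.norm_eq_abs] at h1 h2
  rw [Real.rpow_neg (wt_pos x).le, ← div_eq_mul_inv, le_div_iff₀ (by have := wt_pos x; positivity)]
  have h3 : wt x ^ (3 : ℝ) = wt x ^ 3 := by norm_cast
  rw [h3]
  have h4 : wt x ^ 3 ≤ 2 ^ (3 - 1) * (1 ^ 3 + (2 * π * |x|) ^ 3) :=
    add_pow_le zero_le_one (by positivity) 3
  calc ‖Φ x‖ * wt x ^ 3 ≤ ‖Φ x‖ * (2 ^ (3 - 1) * (1 ^ 3 + (2 * π * |x|) ^ 3)) := by gcongr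
    _ = 4 * (‖Φ x‖ + (2 * π) ^ 3 * (|x| ^ 3 * ‖Φ x‖)) := by ring
    _ ≤ 4 * (A + (2 * π) ^ 3 * B) := by gcongr
    _ ≤ _ := by gcongr; norm_num

lemma kernel_bound (Φ : SchwartzMap ℝ ℂ) :
    ∃ C > 0, ∀ x w : ℝ, w ≠ 0 → ‖Φ (x - w) - Φ x‖ / (2 * π * |w|) ≤
      C * (wt w ^ (-1 : ℝ) * (wt (x - w) ^ (-3 : ℝ) + wt x ^ (-3 : ℝ))) := by
  obtain ⟨A, hA, hA'⟩ := schwartz_decay Φ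
  obtain ⟨B, hB, hB'⟩ := schwartz_decay (SchwartzMap.derivCLM ℂ ℂ Φ)
  have hp := Real.pi_gt_three
  refine ⟨2 * A + B * (1 + 2 * π) ^ (3 : ℝ) * (1 + 2 * π), by positivity, fun x w hw => ?_⟩
  have hw0 : 0 < |w| := abs_pos.mpr hw
  have e0 : 0 < wt w := wt_pos w
  have e1 : 0 < wt (x - w) ^ (-3 : ℝ) := Real.rpow_pos_of_pos (wt_pos _) _
  have e2 : 0 < wt x ^ (-3 : ℝ) := Real.rpow_pos_of_pos (wt_pos _) _
  rw [div_le_iff₀ (by positivity), Real.rpow_neg_one]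
  rcases le_or_gt 1 |w| with h | h
  · have h1 : ‖Φ (x - w) - Φ x‖ ≤ A * (wt (x - w) ^ (-3 : ℝ) + wt x ^ (-3 : ℝ)) := by
      have := norm_sub_le (Φ (x - w)) (Φ x)
      have := hA' x
      have := hA' (x - w)
      linarith
    have h2 : 1 ≤ 2 * ((wt w)⁻¹ * (2 * π * |w|)) := by
      rw [inv_mul_eq_div, mul_div_assoc', le_div_iff₀ e0]
      unfold wt
      nlinarith
    calc _ ≤ _ := h1
      _ ≤ A * (wt (x - w) ^ (-3 : ℝ) + wt x ^ (-3 : ℝ)) * (2 * ((wt w)⁻¹ * (2 * π * |w|))) :=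
        le_mul_of_one_le_right (by positivity) h2
      _ = 2 * A * ((wt w)⁻¹ * (wt (x - w) ^ (-3 : ℝ) + wt x ^ (-3 : ℝ))) * (2 * π * |w|) := by ring
      _ ≤ _ := by
        gcongr
        have : 0 ≤ B * (1 + 2 * π) ^ (3 : ℝ) * (1 + 2 * π) := by positivity
        linarith
  · have h1 : ‖Φ (x - w) - Φ x‖ ≤ (B * ((1 + 2 * π) ^ (3 : ℝ) * wt x ^ (-3 : ℝ))) * ‖(x - w) - x‖ := by
      refine Convex.norm_image_sub_le_of_norm_deriv_le (s := Metric.closedBall x |w|)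
        (fun z _ => Φ.differentiableAt) (fun z hz => ?_) (convex_closedBall _ _)
        (Metric.mem_closedBall_self hw0.le) (by simp [Metric.mem_closedBall])
      refine (hB' z).trans ?_
      gcongr
      have hz' : |x - z| ≤ |w| := by
        rw [abs_sub_comm]; simpa [Metric.mem_closedBall, Real.dist_eq] using hz
      have h5 : wt x ≤ (1 + 2 * π) * wt z := by
        refine (wt_mul_le x z).trans ?_
        rw [mul_comm]
        have := (wt_pos z).le
        gcongr
        unfold wt
        nlinarith
      rw [Real.rpow_neg (wt_pos z).le, Real.rpow_neg (wt_pos x).le, ← div_eq_mul_inv,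
        le_div_iff₀ (Real.rpow_pos_of_pos (wt_pos _) _), inv_mul_le_iff₀ (Real.rpow_pos_of_pos (wt_pos _) _),
        mul_comm, ← Real.mul_rpow (by positivity) (wt_pos z).le]
      exact Real.rpow_le_rpow (wt_pos _).le h5 (by norm_num)
    have h2 : 1 ≤ (1 + 2 * π) * (wt w)⁻¹ := by
      rw [← div_eq_mul_inv, le_div_iff₀ e0]
      unfold wt
      nlinarith
    have h3 : ‖(x - w) - x‖ = |w| := by simp
    rw [h3] at h1
    calc _ ≤ _ := h1
      _ ≤ B * ((1 + 2 * π) ^ (3 : ℝ) * wt x ^ (-3 : ℝ)) * |w| * ((1 + 2 * π) * (wt w)⁻¹) :=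
        le_mul_of_one_le_right (by positivity) h2
      _ = (B * (1 + 2 * π) ^ (3 : ℝ) * (1 + 2 * π)) * ((wt w)⁻¹ * (0 + wt x ^ (-3 : ℝ))) * (1 * |w|) := by ring
      _ ≤ _ := by
        gcongr
        · linarith
        · linarith

lemma weighted_kernel (b b' : ℝ) (hb0 : 0 ≤ b) (hb1 : b ≤ b' + 1) (hb'2 : b' ≤ 0) (x w : ℝ) :
    wt x ^ b * (wt w ^ (-1 : ℝ) * (wt (x - w) ^ (-3 : ℝ) + wt x ^ (-3 : ℝ))) ≤
      ((wt (x - w) ^ (-1 : ℝ)) ^ 2 + (wt x ^ (-1 : ℝ)) ^ 2 * wt w ^ (-1 - b')) * wt w ^ b' := by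
  have p0 := wt_pos x
  have p1 := wt_pos w
  have p2 := wt_pos (x - w)
  have q0 := wt_one_le x
  have q1 := wt_one_le w
  have q2 := wt_one_le (x - w)
  have s : ∀ y, (wt y ^ (-1 : ℝ)) ^ 2 = wt y ^ (-2 : ℝ) := fun y => by
    rw [← Real.rpow_natCast, ← Real.rpow_mul (wt_pos y).le]; norm_num
  have a1 : wt w ^ (-1 - b') * wt w ^ b' = wt w ^ (-1 : ℝ) := by
    rw [← Real.rpow_add p1]; congr 1; ring
  have a2 : wt x ^ b * wt x ^ (-3 : ℝ) ≤ wt x ^ (-2 : ℝ) := by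
    rw [← Real.rpow_add p0]
    exact Real.rpow_le_rpow_of_exponent_le q0 (by linarith)
  have a3 : wt x ^ b ≤ wt w ^ b * wt (x - w) ^ b := by
    rw [← Real.mul_rpow p1.le p2.le]
    exact Real.rpow_le_rpow p0.le (wt_mul_le x w) hb0
  have a4 : wt w ^ b * wt w ^ (-1 : ℝ) ≤ wt w ^ b' := by
    rw [← Real.rpow_add p1]
    exact Real.rpow_le_rpow_of_exponent_le q1 (by linarith)
  have a5 : wt (x - w) ^ b * wt (x - w) ^ (-3 : ℝ) ≤ wt (x - w) ^ (-2 : ℝ) := by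
    rw [← Real.rpow_add p2]
    exact Real.rpow_le_rpow_of_exponent_le q2 (by linarith)
  rw [s, s]
  calc _ = wt x ^ b * (wt w ^ (-1 : ℝ) * wt (x - w) ^ (-3 : ℝ)) +
        (wt x ^ b * wt x ^ (-3 : ℝ)) * wt w ^ (-1 : ℝ) := by ring
    _ ≤ (wt w ^ b * wt (x - w) ^ b) * (wt w ^ (-1 : ℝ) * wt (x - w) ^ (-3 : ℝ)) +
        wt x ^ (-2 : ℝ) * wt w ^ (-1 : ℝ) := by gcongr
    _ = (wt w ^ b * wt w ^ (-1 : ℝ)) * (wt (x - w) ^ b * wt (x - w) ^ (-3 : ℝ)) +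
        wt x ^ (-2 : ℝ) * (wt w ^ (-1 - b') * wt w ^ b') := by rw [a1]; ring
    _ ≤ wt w ^ b' * wt (x - w) ^ (-2 : ℝ) +
        wt x ^ (-2 : ℝ) * (wt w ^ (-1 - b') * wt w ^ b') := by gcongr
    _ = _ := by ring

lemma lintegral_cs (u v : ℝ → ℝ≥0∞) (hu : Measurable u) (hv : Measurable v) :
    (∫⁻ w, u w * v w) ^ 2 ≤ (∫⁻ w, u w ^ 2) * ∫⁻ w, v w ^ 2 := by
  have h := ENNReal.lintegral_mul_le_Lp_mul_Lq volume
    (Real.HolderConjugate.two_two) hu.aemeasurable hv.aemeasurable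
  have h' := ENNReal.rpow_le_rpow h (z := 2) (by norm_num)
  rw [ENNReal.mul_rpow_of_nonneg _ _ (by norm_num), ← ENNReal.rpow_mul, ← ENNReal.rpow_mul] at h'
  norm_num at h'
  simpa using h'

lemma ennreal_add_sq (a c : ℝ≥0∞) : (a + c) ^ 2 ≤ 2 * (a ^ 2 + c ^ 2) := by
  have h := ENNReal.rpow_add_le_mul_rpow_add_rpow a c (p := 2) (by norm_num)
  norm_num at h
  simpa using h

lemma schur_bound (S P G : ℝ → ℝ≥0∞) (hS : Measurable S) (hP : Measurable P) (hG : Measurable G) :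
    ∫⁻ x, (∫⁻ w, (S (x - w) ^ 2 + S x ^ 2 * P w) * G w) ^ 2 ≤
      2 * ((∫⁻ x, S x ^ 2) ^ 2 + (∫⁻ x, S x ^ 4) * ∫⁻ w, P w ^ 2) * ∫⁻ w, G w ^ 2 := by
  have key : ∀ x, (∫⁻ w, (S (x - w) ^ 2 + S x ^ 2 * P w) * G w) ^ 2 ≤
      2 * ((∫⁻ x, S x ^ 2) * (∫⁻ w, S (x - w) ^ 2 * G w ^ 2) +
        S x ^ 4 * ((∫⁻ w, P w ^ 2) * ∫⁻ w, G w ^ 2)) := by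
    intro x
    have hSx : Measurable fun w => S (x - w) := hS.comp (by fun_prop)
    have e : ∫⁻ w, (S (x - w) ^ 2 + S x ^ 2 * P w) * G w =
        (∫⁻ w, S (x - w) * (S (x - w) * G w)) + S x ^ 2 * ∫⁻ w, P w * G w := by
      rw [← lintegral_const_mul _ (by fun_prop), ← lintegral_add_left (by fun_prop)]
      congr 1; ext w; ring
    rw [e]
    refine (ennreal_add_sq _ _).trans ?_
    gcongr
    · refine (lintegral_cs (fun w => S (x - w)) (fun w => S (x - w) * G w) hSx (hSx.mul hG)).trans ?_
      rw [lintegral_sub_left_eq_self (fun w => S w ^ 2) x]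
      simp only [mul_pow]; exact le_rfl
    · rw [mul_pow, ← pow_mul]
      gcongr
      exact lintegral_cs _ _ hP hG
  refine (lintegral_mono key).trans ?_
  have hm : Measurable (fun p : ℝ × ℝ => S (p.1 - p.2) ^ 2 * G p.2 ^ 2) := by
    have : Measurable (fun p : ℝ × ℝ => S (p.1 - p.2)) := hS.comp (by fun_prop)
    fun_prop
  have h2 : ∫⁻ x, ∫⁻ w, S (x - w) ^ 2 * G w ^ 2 = (∫⁻ x, S x ^ 2) * ∫⁻ w, G w ^ 2 := by
    rw [lintegral_lintegral_swap hm.aemeasurable]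
    rw [← lintegral_const_mul _ (by fun_prop)]
    congr 1; ext w
    have : Measurable (fun x : ℝ => S (x - w)) := hS.comp (by fun_prop)
    rw [lintegral_mul_const _ (by fun_prop), lintegral_sub_right_eq_self (fun x => S x ^ 2) w]
  have hm1 : Measurable fun x => ∫⁻ w, S (x - w) ^ 2 * G w ^ 2 := hm.lintegral_prod_right'
  rw [lintegral_const_mul _ (by fun_prop), lintegral_add_left (by fun_prop),
    lintegral_const_mul _ (by fun_prop), lintegral_mul_const _ (by fun_prop), h2]
  apply le_of_eq; ring

/-- The primitive of a character. -/
noncomputable def Ek (t w : ℝ) : ℂ :=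
  (Complex.exp (Complex.I * (2 * π * w * t : ℝ)) - 1) / (2 * π * w * Complex.I)

lemma Ek_norm_le (t w : ℝ) : ‖Ek t w‖ ≤ |t| := by
  unfold Ek
  rcases eq_or_ne w 0 with rfl | hw
  · simp
  · have hp := Real.pi_pos
    have hw0 : 0 < |w| := abs_pos.mpr hw
    have e : ‖(2 * π * w * Complex.I : ℂ)‖ = 2 * π * |w| := by
      simp [abs_of_pos hp]
    rw [norm_div, e, div_le_iff₀ (by positivity)]
    refine Real.norm_exp_I_mul_ofReal_sub_one_le.trans (le_of_eq ?_)
    simp only [Real.norm_eq_abs, abs_mul, abs_of_pos hp]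
    norm_num; ring

lemma Ek_measurable : Measurable (fun p : ℝ × ℝ => Ek p.1 p.2) := by
  unfold Ek; fun_prop

lemma primitive_rep (f : SchwartzMap ℝ ℂ) (t : ℝ) :
    ∫ s in (0 : ℝ)..t, f s = ∫ w, (𝓕 f) w * Ek t w := by
  have inv : ∀ s, f s = ∫ w, Complex.exp (Complex.I * (2 * π * w * s : ℝ)) * (𝓕 f) w := by
    intro s
    have h : 𝓕⁻ (𝓕 f) = f := FourierTransform.fourierInv_fourier_eq f
    conv_lhs => rw [← h]
    rw [SchwartzMap.fourierInv_coe, Real.fourierInv_eq']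
    refine integral_congr_ae (ae_of_all _ fun w => ?_)
    simp only [smul_eq_mul, RCLike.inner_apply, conj_trivial]
    congr 2
    push_cast; ring
  simp_rw [inv]
  rw [intervalIntegral_integral_swap]
  · refine integral_congr_ae ?_
    have h0 : ∀ᵐ w : ℝ, w ≠ 0 := by simp [ae_iff]
    filter_upwards [h0] with w hw
    rw [intervalIntegral.integral_mul_const, mul_comm]
    congr 1
    have hc : (2 * π * w * Complex.I : ℂ) ≠ 0 := by
      simp [hw, Real.pi_ne_zero]
    have := integral_exp_mul_complex (a := 0) (b := t) hc
    unfold Ek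
    rw [show (Complex.exp (Complex.I * (2 * π * w * t : ℝ)) - 1) / (2 * π * w * Complex.I) =
      (Complex.exp ((2 * π * w * Complex.I) * t) - Complex.exp ((2 * π * w * Complex.I) * (0 : ℝ))) / (2 * π * w * Complex.I) by
        congr 2
        · congr 1; push_cast; ring
        · simp, ← this]
    congr 1; ext x; congr 1; push_cast; ring
  · have h1 : Integrable (fun p : ℝ × ℝ => (1 : ℝ) * ‖(𝓕 f) p.2‖)
        ((volume.restrict (Set.uIoc 0 t)).prod volume) := by
      have hc : Integrable (fun _ : ℝ => (1 : ℝ)) (volume.restrict (Set.uIoc 0 t)) := by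
        rw [integrable_const_iff]
        right
        exact ⟨by rw [Measure.restrict_apply_univ, Set.uIoc]; exact measure_Ioc_lt_top⟩
      exact hc.mul_prod ((𝓕 f).integrable (μ := volume)).norm
    refine h1.mono' ?_ (ae_of_all _ fun p => ?_)
    · have hc : Continuous (𝓕 f : SchwartzMap ℝ ℂ) := (𝓕 f).continuous
      apply Continuous.aestronglyMeasurable
      unfold Function.uncurry
      fun_prop
    · simp only [Function.uncurry, norm_mul, one_mul]
      rw [mul_comm Complex.I, Complex.norm_exp_ofReal_mul_I, one_mul]

lemma fourier_L (H f : SchwartzMap ℝ ℂ) (x : ℝ) :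
    𝓕 (fun t => H t * ∫ s in (0 : ℝ)..t, f s) x =
      ∫ w : ℝ, (𝓕 f) w * (((𝓕 H) (x - w) - (𝓕 H) x) / (2 * π * w * Complex.I)) := by
  rw [Real.fourier_real_eq_integral_exp_smul]
  simp_rw [primitive_rep, smul_eq_mul, ← mul_assoc, ← integral_const_mul]
  rw [integral_integral_swap]
  · refine integral_congr_ae (ae_of_all _ fun w => ?_)
    simp only
    have hF : ∀ y, (𝓕 H) y = ∫ t : ℝ, Complex.exp (↑(-2 * π * t * y) * Complex.I) * H t := fun y => by
      rw [SchwartzMap.fourier_coe, Real.fourier_real_eq_integral_exp_smul]; rfl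
    have hI : ∀ y : ℝ, Integrable fun t : ℝ => Complex.exp (↑(-2 * π * t * y) * Complex.I) * H t := by
      intro y
      refine H.integrable.norm.mono' ?_ (ae_of_all _ fun t => ?_)
      · have := H.continuous
        apply Continuous.aestronglyMeasurable; fun_prop
      · rw [norm_mul, Complex.norm_exp_ofReal_mul_I, one_mul]
    rw [hF, hF, ← integral_sub (hI _) (hI _), ← integral_div, ← integral_const_mul]
    congr 1; ext t
    unfold Ek
    have : Complex.exp (↑(-2 * π * t * (x - w)) * Complex.I) =
        Complex.exp (↑(-2 * π * t * x) * Complex.I) * Complex.exp (Complex.I * (2 * π * w * t : ℝ)) := by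
      rw [← Complex.exp_add]; congr 1; push_cast; ring
    rw [this]; ring
  · have h1 : Integrable (fun p : ℝ × ℝ => (‖p.1‖ ^ 1 * ‖H p.1‖) * ‖(𝓕 f) p.2‖)
        (volume.prod volume) := by
      exact Integrable.mul_prod (f := fun t : ℝ => ‖t‖ ^ 1 * ‖H t‖) (g := fun w => ‖(𝓕 f) w‖)
        (H.integrable_pow_mul volume 1) ((𝓕 f).integrable (μ := volume)).norm
    refine h1.mono' ?_ (ae_of_all _ fun p => ?_)
    · have hc : Continuous (𝓕 f : SchwartzMap ℝ ℂ) := (𝓕 f).continuous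
      have hc' := H.continuous
      have := Ek_measurable
      have m1 : Measurable fun p : ℝ × ℝ => H p.1 := (by fun_prop : Continuous fun p : ℝ × ℝ => H p.1).measurable
      have m2 : Measurable fun p : ℝ × ℝ => (𝓕 f) p.2 := (by fun_prop : Continuous fun p : ℝ × ℝ => (𝓕 f) p.2).measurable
      apply Measurable.aestronglyMeasurable
      unfold Function.uncurry
      fun_prop
    · simp only [Function.uncurry, norm_mul]
      rw [Complex.norm_exp_ofReal_mul_I, one_mul, pow_one]
      have := Ek_norm_le p.1 p.2
      calc _ ≤ ‖H p.1‖ * (‖(𝓕 f) p.2‖ * |p.1|) := by gcongr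
        _ = _ := by rw [Real.norm_eq_abs]; ring

lemma FT1_eq (f : ℝ → ℂ) (τ : ℝ) : FT1 f τ = (Real.sqrt (2 * π) : ℂ)⁻¹ * 𝓕 f (τ / (2 * π)) := by
  unfold FT1
  rw [Real.fourier_real_eq_integral_exp_smul]
  congr 2; ext t
  rw [smul_eq_mul]; congr 2
  have := Real.pi_ne_zero
  have h : -2 * π * t * (τ / (2 * π)) = - τ * t := by field_simp
  rw [h]; push_cast; ring

lemma Hnorm_sq_eq (r : ℝ) (f : ℝ → ℂ) :
    ∫ τ : ℝ, (1 + |τ|) ^ (2 * r) * ‖FT1 f τ‖ ^ 2 = ∫ w, wt w ^ (2 * r) * ‖𝓕 f w‖ ^ 2 := by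
  have hp := Real.pi_pos
  have h := Measure.integral_comp_div (fun w => wt w ^ (2 * r) * ‖𝓕 f w‖ ^ 2) (2 * π)
  rw [abs_of_pos (by positivity), smul_eq_mul] at h
  have h2 : ∫ w, wt w ^ (2 * r) * ‖𝓕 f w‖ ^ 2 =
      (2 * π)⁻¹ * ∫ τ : ℝ, wt (τ / (2 * π)) ^ (2 * r) * ‖𝓕 f (τ / (2 * π))‖ ^ 2 := by
    rw [h]; field_simp
  rw [h2, ← integral_const_mul]
  congr 1; ext τ
  rw [FT1_eq, norm_mul, norm_inv, Complex.norm_real, Real.norm_of_nonneg (Real.sqrt_nonneg _), mul_pow, inv_pow,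
    Real.sq_sqrt (by positivity)]
  have : wt (τ / (2 * π)) = 1 + |τ| := by
    unfold wt
    rw [abs_div, abs_of_pos (show 0 < 2 * π by positivity)]
    field_simp
  rw [this]; ring

lemma unit_time (b b' : ℝ) (hb'1 : -(1 / 2 : ℝ) < b') (hb'2 : b' ≤ 0) (hb0 : 0 ≤ b)
    (hb1 : b ≤ b' + 1) (H : SchwartzMap ℝ ℂ) :
    ∃ D : ℝ, 0 ≤ D ∧ ∀ f : SchwartzMap ℝ ℂ,
      Integrable (fun w => wt w ^ (2 * b) * ‖𝓕 (fun t => H t * ∫ s in (0 : ℝ)..t, f s) w‖ ^ 2) ∧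
      (∫ w, wt w ^ (2 * b) * ‖𝓕 (fun t => H t * ∫ s in (0 : ℝ)..t, f s) w‖ ^ 2 ≤
        D * ∫ w, wt w ^ (2 * b') * ‖𝓕 (f : ℝ → ℂ) w‖ ^ 2) ∧
      Integrable (fun w => wt w ^ (2 * b') * ‖𝓕 (f : ℝ → ℂ) w‖ ^ 2) := by
  obtain ⟨M, hM, hK⟩ := kernel_bound (𝓕 H)
  set S : ℝ → ℝ≥0∞ := fun w => ENNReal.ofReal (wt w ^ (-1 : ℝ)) with hS
  set P : ℝ → ℝ≥0∞ := fun w => ENNReal.ofReal (wt w ^ (-1 - b')) with hP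
  have mS : Measurable S := (wt_rpow_continuous _).measurable.ennreal_ofReal
  have mP : Measurable P := (wt_rpow_continuous _).measurable.ennreal_ofReal
  have pow_eq : ∀ (r : ℝ) (n : ℕ) (w : ℝ),
      ENNReal.ofReal (wt w ^ r) ^ n = ENNReal.ofReal (wt w ^ (-(-(r * n)))) := by
    intro r n w
    rw [← ENNReal.ofReal_pow (Real.rpow_nonneg (wt_pos w).le _), neg_neg, Real.rpow_mul (wt_pos w).le,
      Real.rpow_natCast]
  have fin : ∀ (r : ℝ) (n : ℕ), 1 < -(r * n) → ∫⁻ w, ENNReal.ofReal (wt w ^ r) ^ n ≠ ∞ := by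
    intro r n h
    simp_rw [pow_eq]
    exact (integrable_wt h).lintegral_lt_top.ne
  have f1 : ∫⁻ w, S w ^ 2 ≠ ∞ := fin _ _ (by norm_num)
  have f2 : ∫⁻ w, S w ^ 4 ≠ ∞ := fin _ _ (by norm_num)
  have f3 : ∫⁻ w, P w ^ 2 ≠ ∞ := fin _ _ (by push_cast; linarith)
  set D0 : ℝ≥0∞ := ENNReal.ofReal M ^ 2 * (2 * ((∫⁻ x, S x ^ 2) ^ 2 + (∫⁻ x, S x ^ 4) * ∫⁻ w, P w ^ 2)) with hD0
  have fD : D0 ≠ ∞ := by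
    refine ENNReal.mul_ne_top (by simp) (ENNReal.mul_ne_top (by simp) (ENNReal.add_ne_top.mpr ⟨?_, ?_⟩))
    · exact ENNReal.pow_ne_top f1
    · exact ENNReal.mul_ne_top f2 f3
  refine ⟨D0.toReal, ENNReal.toReal_nonneg, fun f => ?_⟩
  set u : ℝ → ℂ := 𝓕 (fun t => H t * ∫ s in (0 : ℝ)..t, f s) with hu
  have hcf : Continuous (𝓕 f : SchwartzMap ℝ ℂ) := (𝓕 f).continuous
  have hcH : Continuous (𝓕 H : SchwartzMap ℝ ℂ) := (𝓕 H).continuous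
  have hrep : ∀ x, u x = ∫ w : ℝ, (𝓕 f) w * (((𝓕 H) (x - w) - (𝓕 H) x) / (2 * π * w * Complex.I)) :=
    fourier_L H f
  have mu : Measurable u := by
    have : u = fun x => ∫ w : ℝ, (𝓕 f) w * (((𝓕 H) (x - w) - (𝓕 H) x) / (2 * π * w * Complex.I)) :=
      funext hrep
    rw [this]
    have m : Measurable (fun p : ℝ × ℝ => (𝓕 f) p.2 * (((𝓕 H) (p.1 - p.2) - (𝓕 H) p.1) / (2 * π * p.2 * Complex.I))) := by
      have m1 : Measurable fun p : ℝ × ℝ => (𝓕 f) p.2 := (by fun_prop : Continuous fun p : ℝ × ℝ => (𝓕 f) p.2).measurable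
      have m2 : Measurable fun p : ℝ × ℝ => (𝓕 H) p.1 := (by fun_prop : Continuous fun p : ℝ × ℝ => (𝓕 H) p.1).measurable
      have m3 : Measurable fun p : ℝ × ℝ => (𝓕 H) (p.1 - p.2) :=
        (by fun_prop : Continuous fun p : ℝ × ℝ => (𝓕 H) (p.1 - p.2)).measurable
      fun_prop
    exact (m.stronglyMeasurable.integral_prod_right').measurable
  set G : ℝ → ℝ≥0∞ := fun w => ENNReal.ofReal (wt w ^ b' * ‖(𝓕 f) w‖) with hG
  have mG : Measurable G :=
    ((wt_rpow_continuous b').mul hcf.norm).measurable.ennreal_ofReal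
  have sqr : ∀ (r : ℝ) (v : ℂ) (w : ℝ), ENNReal.ofReal (wt w ^ (2 * r) * ‖v‖ ^ 2) =
      ENNReal.ofReal (wt w ^ r * ‖v‖) ^ 2 := by
    intro r v w
    rw [← ENNReal.ofReal_pow (mul_nonneg (Real.rpow_nonneg (wt_pos w).le _) (norm_nonneg _)), mul_pow,
      mul_comm 2 r, Real.rpow_mul (wt_pos w).le]
    norm_num
  have point : ∀ x, ENNReal.ofReal (wt x ^ (2 * b) * ‖u x‖ ^ 2) ≤
      ENNReal.ofReal M ^ 2 * (∫⁻ w, (S (x - w) ^ 2 + S x ^ 2 * P w) * G w) ^ 2 := by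
    intro x
    have mSx : Measurable fun w => S (x - w) := mS.comp (by fun_prop)
    rw [sqr, ← mul_pow, ← lintegral_const_mul _ (by fun_prop)]
    gcongr
    rw [ENNReal.ofReal_mul (Real.rpow_nonneg (wt_pos x).le _), ofReal_norm, hrep x]
    refine (mul_le_mul_right (enorm_integral_le_lintegral_enorm _) _).trans ?_
    rw [← lintegral_const_mul' _ _ ENNReal.ofReal_ne_top]
    refine lintegral_mono_ae ?_
    have h0 : ∀ᵐ w : ℝ, w ≠ 0 := by simp [ae_iff]
    filter_upwards [h0] with w hw
    have a0 := Real.rpow_nonneg (wt_pos x).le b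
    have a1 := Real.rpow_nonneg (wt_pos x).le (-1)
    have a2 := Real.rpow_nonneg (wt_pos w).le (-1 - b')
    have a3 := Real.rpow_nonneg (wt_pos (x - w)).le (-1)
    have a4 := Real.rpow_nonneg (wt_pos w).le b'
    simp only [hS, hP, hG]
    rw [← ofReal_norm, ← ENNReal.ofReal_mul a0, ← ENNReal.ofReal_pow a3, ← ENNReal.ofReal_pow a1,
      ← ENNReal.ofReal_mul (by positivity), ← ENNReal.ofReal_add (by positivity) (by positivity),
      ← ENNReal.ofReal_mul (by positivity), ← ENNReal.ofReal_mul hM.le]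
    apply ENNReal.ofReal_le_ofReal
    have e : ‖(2 * π * w * Complex.I : ℂ)‖ = 2 * π * |w| := by
      simp [abs_of_pos Real.pi_pos]
    rw [norm_mul, norm_div, e]
    have k1 := hK x w hw
    have k2 := weighted_kernel b b' hb0 hb1 hb'2 x w
    calc _ ≤ wt x ^ b * (‖(𝓕 f) w‖ * (M * (wt w ^ (-1 : ℝ) * (wt (x - w) ^ (-3 : ℝ) + wt x ^ (-3 : ℝ))))) := by
          gcongr
      _ = M * (wt x ^ b * (wt w ^ (-1 : ℝ) * (wt (x - w) ^ (-3 : ℝ) + wt x ^ (-3 : ℝ)))) * ‖(𝓕 f) w‖ := by ring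
      _ ≤ M * (((wt (x - w) ^ (-1 : ℝ)) ^ 2 + (wt x ^ (-1 : ℝ)) ^ 2 * wt w ^ (-1 - b')) * wt w ^ b') * ‖(𝓕 f) w‖ := by
          gcongr
      _ = _ := by ring
  have hGint : Integrable fun w => wt w ^ (2 * b') * ‖(𝓕 f) w‖ ^ 2 := by
    obtain ⟨A, hA, hA'⟩ := schwartz_decay (𝓕 f)
    have hI := ((𝓕 f).integrable (μ := volume)).norm.const_mul A
    refine hI.mono' ?_ (ae_of_all _ fun w => ?_)
    · exact ((wt_rpow_continuous _).mul (hcf.norm.pow 2)).aestronglyMeasurable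
    · rw [Real.norm_of_nonneg (mul_nonneg (Real.rpow_nonneg (wt_pos w).le _) (by positivity))]
      have q1 : wt w ^ (2 * b') ≤ 1 := Real.rpow_le_one_of_one_le_of_nonpos (wt_one_le w) (by linarith)
      have q2 : ‖(𝓕 f) w‖ ≤ A := (hA' w).trans (by
        have : wt w ^ (-3 : ℝ) ≤ 1 := Real.rpow_le_one_of_one_le_of_nonpos (wt_one_le w) (by norm_num)
        nlinarith)
      calc _ ≤ 1 * ‖(𝓕 f) w‖ ^ 2 := by gcongr
        _ = ‖(𝓕 f) w‖ * ‖(𝓕 f) w‖ := by ring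
        _ ≤ _ := by gcongr
  have nnG : ∀ w, 0 ≤ wt w ^ (2 * b') * ‖(𝓕 f) w‖ ^ 2 := fun w =>
    mul_nonneg (Real.rpow_nonneg (wt_pos w).le _) (by positivity)
  have nnu : ∀ w, 0 ≤ wt w ^ (2 * b) * ‖u w‖ ^ 2 := fun w =>
    mul_nonneg (Real.rpow_nonneg (wt_pos w).le _) (by positivity)
  have hGe : ∫⁻ w, G w ^ 2 = ENNReal.ofReal (∫ w, wt w ^ (2 * b') * ‖(𝓕 f) w‖ ^ 2) := by
    rw [ofReal_integral_eq_lintegral_ofReal hGint (ae_of_all _ nnG)]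
    congr 1; ext w; rw [sqr]
  have tot : ∫⁻ x, ENNReal.ofReal (wt x ^ (2 * b) * ‖u x‖ ^ 2) ≤
      D0 * ENNReal.ofReal (∫ w, wt w ^ (2 * b') * ‖(𝓕 f) w‖ ^ 2) := by
    refine (lintegral_mono point).trans ?_
    rw [lintegral_const_mul' _ _ (by simp), ← hGe, hD0, mul_assoc]
    gcongr
    exact schur_bound S P G mS mP mG
  have tfin : D0 * ENNReal.ofReal (∫ w, wt w ^ (2 * b') * ‖(𝓕 f) w‖ ^ 2) ≠ ∞ :=
    ENNReal.mul_ne_top fD ENNReal.ofReal_ne_top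
  have mI : AEStronglyMeasurable (fun w => wt w ^ (2 * b) * ‖u w‖ ^ 2) volume := by
    have := (wt_rpow_continuous (2 * b)).measurable
    exact (this.mul (mu.norm.pow_const 2)).aestronglyMeasurable
  refine ⟨?_, ?_, hGint⟩
  · refine ⟨mI, ?_⟩
    rw [hasFiniteIntegral_iff_ofReal (ae_of_all _ nnu)]
    exact tot.trans_lt tfin.lt_top
  · rw [integral_eq_lintegral_of_nonneg_ae (ae_of_all _ nnu) mI]
    refine (ENNReal.toReal_mono tfin tot).trans (le_of_eq ?_)
    rw [ENNReal.toReal_mul, ENNReal.toReal_ofReal (integral_nonneg nnG)]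
    rfl

lemma fourier_scale (g : ℝ → ℂ) (a : ℝ) (ha : 0 < a) (w : ℝ) :
    𝓕 (fun t => g (t / a)) w = a * 𝓕 g (a * w) := by
  rw [Real.fourier_real_eq_integral_exp_smul, Real.fourier_real_eq_integral_exp_smul]
  have h := Measure.integral_comp_div (fun v => Complex.exp (↑(-2 * π * v * (a * w)) * Complex.I) • g v) a
  rw [abs_of_pos ha] at h
  rw [← Complex.real_smul, ← h]
  congr 1; ext t
  congr 4
  field_simp

lemma norm_scale (g : ℝ → ℂ) (a : ℝ) (ha : 0 < a) (r : ℝ) :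
    ∫ w, wt w ^ (2 * r) * ‖𝓕 (fun t => g (t / a)) w‖ ^ 2 =
      a * ∫ w, wt (w / a) ^ (2 * r) * ‖𝓕 g w‖ ^ 2 := by
  have h := Measure.integral_comp_mul_left (fun w => wt (w / a) ^ (2 * r) * ‖𝓕 g w‖ ^ 2) a
  rw [abs_of_pos (by positivity), smul_eq_mul] at h
  have h2 : a * ∫ w, wt (w / a) ^ (2 * r) * ‖𝓕 g w‖ ^ 2 =
      a ^ 2 * ∫ w, wt (a * w / a) ^ (2 * r) * ‖𝓕 g (a * w)‖ ^ 2 := by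
    rw [h]; field_simp
  rw [h2, ← integral_const_mul]
  congr 1; ext w
  rw [fourier_scale g a ha, norm_mul, Complex.norm_real, Real.norm_of_nonneg ha.le,
    mul_div_cancel_left₀ _ ha.ne']
  ring

lemma wt_scale (T : ℝ) (hT0 : 0 < T) (hT1 : T ≤ 1) (w : ℝ) : wt w ≤ T⁻¹ * wt (T * w) := by
  unfold wt
  rw [abs_mul, abs_of_pos hT0]
  have : 1 ≤ T⁻¹ := (one_le_inv₀ hT0).mpr hT1
  have e : T⁻¹ * (1 + 2 * π * (T * |w|)) = T⁻¹ + 2 * π * |w| := by field_simp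
  rw [e]; linarith

theorem stmt1 (b b' : ℝ) (hb'1 : -(1 / 2 : ℝ) < b') (hb'2 : b' ≤ 0) (hb0 : 0 ≤ b)
    (hb1 : b ≤ b' + 1)
    (η : ℝ → ℂ) (hηsmooth : ContDiff ℝ (⊤ : ℕ∞) η)
    (hηsupp : Function.support η ⊆ Set.Icc (-1 : ℝ) 1)
    (hηone : ∀ t ∈ Set.Icc (-(1 / 2) : ℝ) (1 / 2), η t = 1) :
    ∃ C > (0 : ℝ), ∀ T ∈ Set.Ioc (0 : ℝ) 1, ∀ f : SchwartzMap ℝ ℂ,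
      Hnorm b (fun t => η (t / T) * ∫ t' in (0 : ℝ)..t, f t') ≤
        C * T ^ (1 - b + b') * Hnorm b' f := by
  have hcs : HasCompactSupport η := HasCompactSupport.of_support_subset_isCompact isCompact_Icc hηsupp
  obtain ⟨D, hD, hmain⟩ := unit_time b b' hb'1 hb'2 hb0 hb1 (hcs.toSchwartzMap hηsmooth)
  refine ⟨Real.sqrt D + 1, by positivity, fun T hT f => ?_⟩
  obtain ⟨hT0, hT1⟩ := hT
  let e : ℝ ≃L[ℝ] ℝ := ContinuousLinearEquiv.unitsEquivAut ℝ (Units.mk0 T hT0.ne')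
  let fT : SchwartzMap ℝ ℂ := SchwartzMap.compCLMOfContinuousLinearEquiv ℂ e f
  have hfT : ∀ t, fT t = f (t * T) := fun t => rfl
  obtain ⟨hIntg, hle, -⟩ := hmain fT
  set g : ℝ → ℂ := fun t => (hcs.toSchwartzMap hηsmooth) t * ∫ s in (0 : ℝ)..t, fT s with hg
  have e1 : (fun t => η (t / T) * ∫ t' in (0 : ℝ)..t, f t') = fun t => (T : ℂ) • g (t / T) := by
    ext t
    have : ∫ s in (0 : ℝ)..(t / T), fT s = T⁻¹ • ∫ s in (0 : ℝ)..t, f s := by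
      simp_rw [hfT]
      rw [intervalIntegral.integral_comp_mul_right _ hT0.ne']
      congr 2
      · simp
      · field_simp
    simp only [hg, this, Complex.real_smul, smul_eq_mul]
    have : (T : ℂ) ≠ 0 := by exact_mod_cast hT0.ne'
    have h2 : (hcs.toSchwartzMap hηsmooth) (t / T) = η (t / T) := rfl
    rw [h2]; push_cast; field_simp
  have e2 : ∫ w, wt w ^ (2 * b) * ‖𝓕 (fun t => η (t / T) * ∫ t' in (0 : ℝ)..t, f t') w‖ ^ 2 =
      T ^ 2 * (T * ∫ w, wt (w / T) ^ (2 * b) * ‖𝓕 g w‖ ^ 2) := by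
    rw [← norm_scale g T hT0, ← integral_const_mul, e1]
    congr 1; ext w
    have : 𝓕 (fun t => (T : ℂ) • g (t / T)) w = (T : ℂ) • 𝓕 (fun t => g (t / T)) w := by
      rw [Real.fourier_real_eq_integral_exp_smul, Real.fourier_real_eq_integral_exp_smul, ← integral_smul]
      congr 1; ext t; simp only [smul_eq_mul]; ring
    rw [this, norm_smul, Complex.norm_real, Real.norm_of_nonneg hT0.le]; ring
  have e3 : ∫ w, wt w ^ (2 * b') * ‖𝓕 (fT : ℝ → ℂ) w‖ ^ 2 =
      T⁻¹ * ∫ w, wt (w / T⁻¹) ^ (2 * b') * ‖𝓕 (f : ℝ → ℂ) w‖ ^ 2 := by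
    rw [← norm_scale _ T⁻¹ (inv_pos.mpr hT0)]
    have : (fT : ℝ → ℂ) = fun t => f (t / T⁻¹) := by
      ext t; rw [hfT, div_inv_eq_mul]
    rw [this]
  have nn : ∀ (r : ℝ) (h : ℝ → ℂ) (c w : ℝ), 0 ≤ wt (w / c) ^ r * ‖𝓕 h w‖ ^ 2 := fun r h c w =>
    mul_nonneg (Real.rpow_nonneg (wt_pos _).le _) (by positivity)
  have hTr : ∀ r : ℝ, (T⁻¹) ^ r = T ^ (-r) := fun r => by
    rw [Real.inv_rpow hT0.le, Real.rpow_neg hT0.le]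
  have i1 : ∫ w, wt (w / T) ^ (2 * b) * ‖𝓕 g w‖ ^ 2 ≤
      T ^ (-(2 * b)) * ∫ w, wt w ^ (2 * b) * ‖𝓕 g w‖ ^ 2 := by
    rw [← integral_const_mul]
    refine integral_mono_of_nonneg (ae_of_all _ (nn _ _ _)) (hIntg.const_mul _) (ae_of_all _ fun w => ?_)
    simp only
    rw [← mul_assoc]
    gcongr
    rw [← hTr, ← Real.mul_rpow (by positivity) (wt_pos _).le]
    refine Real.rpow_le_rpow (wt_pos _).le ?_ (by linarith)
    have := wt_scale T hT0 hT1 (w / T)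
    rwa [mul_div_cancel₀ _ hT0.ne'] at this
  have i2 : ∫ w, wt (w / T⁻¹) ^ (2 * b') * ‖𝓕 (f : ℝ → ℂ) w‖ ^ 2 ≤
      T ^ (2 * b') * ∫ w, wt w ^ (2 * b') * ‖𝓕 (f : ℝ → ℂ) w‖ ^ 2 := by
    rw [← integral_const_mul]
    refine integral_mono_of_nonneg (ae_of_all _ (nn _ _ _)) ((hmain f).2.2.const_mul _) (ae_of_all _ fun w => ?_)
    simp only
    rw [← mul_assoc]
    gcongr
    have h3 : T ^ (2 * b') = (T⁻¹) ^ (-(2 * b')) := by rw [hTr, neg_neg]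
    rw [← Real.mul_rpow hT0.le (wt_pos _).le]
    refine Real.rpow_le_rpow_of_nonpos (mul_pos hT0 (wt_pos _)) ?_ (by linarith)
    have := wt_scale T hT0 hT1 w
    rw [div_inv_eq_mul, mul_comm w]
    rwa [inv_mul_eq_div, le_div_iff₀ hT0, mul_comm] at this
  unfold Hnorm
  rw [Hnorm_sq_eq, Hnorm_sq_eq]
  set I := ∫ w, wt w ^ (2 * b') * ‖𝓕 (f : ℝ → ℂ) w‖ ^ 2 with hI
  have hI0 : 0 ≤ I := integral_nonneg fun w => by simpa using nn (2 * b') f 1 w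
  have final : ∫ w, wt w ^ (2 * b) * ‖𝓕 (fun t => η (t / T) * ∫ t' in (0 : ℝ)..t, f t') w‖ ^ 2 ≤
      D * (T ^ (1 - b + b')) ^ 2 * I := by
    rw [e2]
    rw [e3] at hle
    have pT : 0 ≤ T ^ (-(2 * b)) := Real.rpow_nonneg hT0.le _
    calc _ ≤ T ^ 2 * (T * (T ^ (-(2 * b)) * (D * (T⁻¹ * (T ^ (2 * b') * I))))) := by
          gcongr
          refine i1.trans ?_
          gcongr
          refine hle.trans ?_
          gcongr
      _ = D * (T ^ 2 * T ^ (-(2 * b)) * T ^ (2 * b')) * I := by field_simp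
      _ = _ := by
          congr 2
          rw [← Real.rpow_natCast, ← Real.rpow_natCast, ← Real.rpow_add hT0, ← Real.rpow_add hT0,
            ← Real.rpow_mul hT0.le]
          congr 1; push_cast; ring
  have pT : 0 ≤ T ^ (1 - b + b') := Real.rpow_nonneg hT0.le _
  calc _ ≤ Real.sqrt (D * (T ^ (1 - b + b')) ^ 2 * I) := Real.sqrt_le_sqrt final
    _ = Real.sqrt D * T ^ (1 - b + b') * Real.sqrt I := by
      rw [Real.sqrt_mul (by positivity), Real.sqrt_mul hD, Real.sqrt_sq pT]
    _ ≤ _ := by gcongr; linarith
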